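/- Let N be a positive integer, let ρ₀ and ρ_T be Hermitian N×N complex matrices, and let U : ℝ → (N×N complex matrices) be differentiable with U(s) unitary for all s and satisfying the gradient flow equation U'(s) = U(s)·[U(s)† ρ₀ U(s), ρ_T]. Then the fidelity is nondecreasing along the flow: for every s, d/ds Re Tr(U(s)† ρ₀ U(s) ρ_T) = Tr(C(s)† C(s)) ≥ 0, where C(s) = [U(s)† ρ₀ U(s), ρ_T]. -/

import Mathlib

open Matrix

noncomputable section

/-- The matrix commutator `[X, Y] = XY − YX`. -/
def matComm {N : ℕ} (X Y : Matrix (Fin N) (Fin N) ℂ) : Matrix (Fin N) (Fin N) ℂ :=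
  X * Y - Y * X

theorem entry_mul {N : ℕ} {A B : ℝ → Matrix (Fin N) (Fin N) ℂ}
    {A' B' : Matrix (Fin N) (Fin N) ℂ} {s : ℝ}
    (hA : ∀ i j, HasDerivAt (fun t => A t i j) (A' i j) s)
    (hB : ∀ i j, HasDerivAt (fun t => B t i j) (B' i j) s) (i j : Fin N) :
    HasDerivAt (fun t => (A t * B t) i j) ((A' * B s + A s * B') i j) s := by
  simp only [Matrix.mul_apply, Matrix.add_apply, ← Finset.sum_add_distrib]
  exact HasDerivAt.fun_sum fun k _ => (hA i k).mul (hB k j)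

/-- along the gradient flow `U'(s) = U(s)·[U(s)†ρ₀U(s), ρ_T]` through
unitary matrices, the fidelity `Re Tr(U(s)†ρ₀U(s)ρ_T)` is nondecreasing: its derivative
equals `Tr(C(s)†C(s)) ≥ 0` where `C(s) = [U(s)†ρ₀U(s), ρ_T]`.  (Differentiability of the
matrix-valued curve `U` is expressed entrywise.) -/
theorem fidelity_nondecreasing_along_gradient_flow
    (N : ℕ) (hN : 0 < N)
    (ρ₀ ρT : Matrix (Fin N) (Fin N) ℂ)
    (hρ₀ : ρ₀.IsHermitian) (hρT : ρT.IsHermitian)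
    (U : ℝ → Matrix (Fin N) (Fin N) ℂ)
    (hunitary : ∀ s, (U s)ᴴ * U s = 1)
    (hflow : ∀ (s : ℝ) (i j : Fin N),
      HasDerivAt (fun t => U t i j)
        ((U s * matComm ((U s)ᴴ * ρ₀ * U s) ρT) i j) s) :
    ∀ s : ℝ,
      deriv (fun t => (((U t)ᴴ * ρ₀ * U t * ρT).trace).re) s
        = (((matComm ((U s)ᴴ * ρ₀ * U s) ρT)ᴴ * matComm ((U s)ᴴ * ρ₀ * U s) ρT).trace).re ∧
      0 ≤ (((matComm ((U s)ᴴ * ρ₀ * U s) ρT)ᴴ * matComm ((U s)ᴴ * ρ₀ * U s) ρT).trace).re := by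
  intro s
  have hA : ((U s)ᴴ * ρ₀ * U s)ᴴ = (U s)ᴴ * ρ₀ * U s := by
    simp [Matrix.conjTranspose_mul, hρ₀.eq, Matrix.mul_assoc]
  have hF := hflow s
  have h1 : ∀ i j, HasDerivAt (fun t => (U t)ᴴ i j)
      ((U s * matComm ((U s)ᴴ * ρ₀ * U s) ρT)ᴴ i j) s := fun i j => (hF j i).star
  have hc : ∀ (M : Matrix (Fin N) (Fin N) ℂ) (i j : Fin N),
      HasDerivAt (fun _ : ℝ => M i j) ((0 : Matrix (Fin N) (Fin N) ℂ) i j) s :=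
    fun M i j => hasDerivAt_const s (M i j)
  have h4 := entry_mul (A := fun t => (U t)ᴴ * ρ₀ * U t) (B := fun _ => ρT)
    (entry_mul (A := fun t => (U t)ᴴ * ρ₀) (B := U)
      (entry_mul (A := fun t => (U t)ᴴ) (B := fun _ => ρ₀) h1 (hc ρ₀)) hF) (hc ρT)
  have h5 := HasDerivAt.fun_sum (u := Finset.univ) fun i _ => h4 i i
  have h6 := Complex.reCLM.hasFDerivAt.comp_hasDerivAt s h5
  refine ⟨?_, ?_⟩
  · refine h6.deriv.trans ?_
    change Complex.re (Matrix.trace (_ : Matrix (Fin N) (Fin N) ℂ)) = _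
    congr 1
    rw [Matrix.conjTranspose_mul]
    have e : ∀ C : Matrix (Fin N) (Fin N) ℂ,
        (Cᴴ * (U s)ᴴ * ρ₀ + (U s)ᴴ * 0) * U s + (U s)ᴴ * ρ₀ * (U s * C)
          = Cᴴ * ((U s)ᴴ * ρ₀ * U s) + ((U s)ᴴ * ρ₀ * U s) * C := by
      intro C
      simp [Matrix.mul_assoc]
    rw [e]
    generalize (U s)ᴴ * ρ₀ * U s = A at hA
    have hC : (matComm A ρT)ᴴ = -matComm A ρT := by
      simp [matComm, Matrix.conjTranspose_sub, Matrix.conjTranspose_mul, hA, hρT.eq]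
    rw [hC]
    have h7 : matComm A ρT = A * ρT - ρT * A := rfl
    have h8 : (A * matComm A ρT * ρT).trace = (matComm A ρT * (ρT * A)).trace := by
      rw [Matrix.mul_assoc, Matrix.trace_mul_comm, Matrix.mul_assoc]
    rw [Matrix.mul_zero, add_zero, Matrix.add_mul, Matrix.trace_add, h8]
    nth_rewrite 4 [h7]
    rw [Matrix.mul_sub, Matrix.trace_sub]
    simp [Matrix.mul_assoc]
  · open scoped ComplexOrder in
    exact (Complex.le_def.1 (Matrix.posSemidef_conjTranspose_mul_self _).trace_nonneg).1
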